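/- arXiv:math/0211244 — 7 statements merged into one kernel-verified Lean document; each statement's English description precedes it below -/
import Mathlib

section
/- For every set X ⊆ 2^ω which is contained in a Borel set of μ-measure zero, there exists a function f : ℕ → ℕ such that X ⊆ H_f = ⋂_{N<ω} ⋃_{n>N} C^n_{f(n)}. -/
open MeasureTheory Set

/-- The union of all cylinders of length `n` contained in `U`. -/
def prefixInterior (U : Set (ℕ → Bool)) (n : ℕ) : Set (ℕ → Bool) :=
  {x | PiNat.cylinder x n ⊆ U}

lemma prefixInterior_subset (U : Set (ℕ → Bool)) (n : ℕ) : prefixInterior U n ⊆ U :=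
  fun x hx => hx (PiNat.self_mem_cylinder x n)

lemma monotone_prefixInterior (U : Set (ℕ → Bool)) : Monotone (prefixInterior U) :=
  fun _ _ hmn x hx => (PiNat.cylinder_anti x hmn).trans hx

lemma prefixInterior_eq_preimage (U : Set (ℕ → Bool)) (n : ℕ) :
    ∃ S : Set (Fin n → Bool),
      prefixInterior U n = (fun (x : ℕ → Bool) (i : Fin n) => x i) ⁻¹' S := by
  refine ⟨(fun (x : ℕ → Bool) (i : Fin n) => x i) '' prefixInterior U n,
    (subset_preimage_image _ _).antisymm ?_⟩
  rintro x ⟨y, hy, hyx⟩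
  have hxy : x ∈ PiNat.cylinder y n := fun i hi => (congrFun hyx ⟨i, hi⟩).symm
  change PiNat.cylinder x n ⊆ U
  rw [PiNat.mem_cylinder_iff_eq.1 hxy]
  exact hy

lemma isClopen_preimage_prefix {n : ℕ} (S : Set (Fin n → Bool)) :
    IsClopen ((fun (x : ℕ → Bool) (i : Fin n) => x i) ⁻¹' S) :=
  (isClopen_discrete S).preimage (by fun_prop)

lemma isClopen_prefixInterior (U : Set (ℕ → Bool)) (n : ℕ) : IsClopen (prefixInterior U n) := by
  obtain ⟨S, hS⟩ := prefixInterior_eq_preimage U n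
  exact hS ▸ isClopen_preimage_prefix S

lemma IsOpen.iUnion_prefixInterior {U : Set (ℕ → Bool)} (hU : IsOpen U) :
    ⋃ n, prefixInterior U n = U := by
  refine (iUnion_subset (prefixInterior_subset U)).antisymm fun x hx => mem_iUnion.2 ?_
  obtain ⟨_, ⟨y, n, rfl⟩, hxy, hyU⟩ :=
    (PiNat.isTopologicalBasis_cylinders fun _ => Bool).exists_subset_of_mem_open hx hU
  refine ⟨n, ?_⟩
  change PiNat.cylinder x n ⊆ U
  rwa [PiNat.mem_cylinder_iff_eq.1 hxy]

/-- A clopen subset of the Cantor space is determined by finitely many coordinates. -/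
lemma IsClopen.exists_eq_prefixInterior {K : Set (ℕ → Bool)} (hK : IsClopen K) :
    ∃ n, K = prefixInterior K n := by
  obtain ⟨n, hn⟩ := hK.isClosed.isCompact.elim_directed_cover (prefixInterior K)
    (fun n => (isClopen_prefixInterior K n).isOpen) hK.isOpen.iUnion_prefixInterior.ge
    (monotone_prefixInterior K).directed_le
  exact ⟨n, hn.antisymm (prefixInterior_subset K n)⟩

lemma measure_preimage_prefix {μ : Measure (ℕ → Bool)}
    (hμ : ∀ (s : Finset ℕ) (σ : ℕ → Bool),
      μ {x : ℕ → Bool | ∀ i ∈ s, x i = σ i} = (2 : ENNReal)⁻¹ ^ s.card)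
    {n : ℕ} (S : Finset (Fin n → Bool)) :
    μ ((fun (x : ℕ → Bool) (i : Fin n) => x i) ⁻¹' S) = S.card * (2 : ENNReal)⁻¹ ^ n := by
  rw [← sum_measure_preimage_singleton S
    fun y _ => (isClopen_preimage_prefix {y}).isOpen.measurableSet, ← nsmul_eq_mul]
  refine Finset.sum_eq_card_nsmul fun y _ => ?_
  have hy := hμ (Finset.range n) fun i => if hi : i < n then y ⟨i, hi⟩ else false
  rw [Finset.card_range] at hy
  rw [← hy]
  congr 1
  ext x
  simp only [mem_preimage, mem_singleton_iff, funext_iff, Finset.mem_range, mem_ofPred_eq]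
  constructor
  · intro hx i hi
    simpa [hi] using hx ⟨i, hi⟩
  · intro hx i
    simpa using hx i i.2

/-- A clopen set of measure at most `2⁻ᵐ` extends to a clopen set of measure exactly `2⁻ᵐ`. -/
lemma IsClopen.exists_superset_measure_eq {μ : Measure (ℕ → Bool)}
    (hμ : ∀ (s : Finset ℕ) (σ : ℕ → Bool),
      μ {x : ℕ → Bool | ∀ i ∈ s, x i = σ i} = (2 : ENNReal)⁻¹ ^ s.card)
    {K : Set (ℕ → Bool)} (hK : IsClopen K) {m : ℕ} (hKm : μ K ≤ (2 : ENNReal)⁻¹ ^ m) :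
    ∃ U, IsClopen U ∧ K ⊆ U ∧ μ U = (2 : ENNReal)⁻¹ ^ m := by
  classical
  obtain ⟨k, hk⟩ := hK.exists_eq_prefixInterior
  obtain ⟨n, hmn, hn⟩ : ∃ n, m ≤ n ∧ K = prefixInterior K n :=
    ⟨max m k, le_max_left _ _,
      (hk.le.trans (monotone_prefixInterior K (le_max_right m k))).antisymm
        (prefixInterior_subset K _)⟩
  obtain ⟨S, hS⟩ := prefixInterior_eq_preimage K n
  obtain ⟨T, rfl⟩ := S.toFinite.exists_finset_coe
  have hpow : ((2 ^ (n - m) : ℕ) : ENNReal) * (2 : ENNReal)⁻¹ ^ n = (2 : ENNReal)⁻¹ ^ m := by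
    obtain ⟨d, rfl⟩ := Nat.exists_eq_add_of_le hmn
    rw [Nat.add_sub_cancel_left, pow_add, mul_left_comm, Nat.cast_pow, Nat.cast_ofNat, ← mul_pow,
      ENNReal.mul_inv_cancel two_ne_zero ENNReal.ofNat_ne_top, one_pow, mul_one]
  have hcard : T.card ≤ 2 ^ (n - m) := by
    rw [hn, hS, measure_preimage_prefix hμ, ← hpow] at hKm
    exact_mod_cast (ENNReal.mul_le_mul_iff_left (by simp) (by simp)).1 hKm
  obtain ⟨T', hTT', -, hT'⟩ := Finset.exists_subsuperset_card_eq (Finset.subset_univ T) hcard (by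
    simpa using Nat.pow_le_pow_right two_pos (Nat.sub_le n m))
  refine ⟨_, isClopen_preimage_prefix (T' : Set (Fin n → Bool)), ?_, ?_⟩
  · rw [hn, hS]
    exact preimage_mono (by exact_mod_cast hTT')
  · rw [measure_preimage_prefix hμ, hT', hpow]

/-- A null set of the Cantor space is covered by clopen sets of arbitrarily prescribed
positive measure bounds. -/
lemma exists_isClopen_cover_of_measure_zero {μ : Measure (ℕ → Bool)} [IsFiniteMeasure μ]
    {B : Set (ℕ → Bool)} (hB : μ B = 0) {ε : ℕ → ENNReal} (hε : ∀ i, 0 < ε i) :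
    ∃ K : ℕ → Set (ℕ → Bool), (∀ i, IsClopen (K i)) ∧ (∀ i, μ (K i) ≤ ε i) ∧ B ⊆ ⋃ i, K i := by
  obtain ⟨U, hBU, hU, hUε⟩ := B.exists_isOpen_lt_of_lt (ε 0) (hB ▸ hε 0)
  have htail : Filter.Tendsto (fun n => μ (U \ prefixInterior U n)) Filter.atTop (nhds 0) := by
    have hlim := tendsto_measure_iInter_atTop (μ := μ) (s := fun n => U \ prefixInterior U n)
      (fun n => (hU.measurableSet.diff
        (isClopen_prefixInterior U n).isOpen.measurableSet).nullMeasurableSet)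
      (fun _ _ hmn => sdiff_subset_sdiff_right (monotone_prefixInterior U hmn))
      ⟨0, measure_ne_top _ _⟩
    rwa [← sdiff_iUnion, hU.iUnion_prefixInterior, sdiff_self, measure_empty] at hlim
  choose j hij hj using fun i =>
    ((Filter.eventually_ge_atTop i).and (htail.eventually_lt_const (hε (i + 1)))).exists
  set A : ℕ → Set (ℕ → Bool) := fun i => prefixInterior U (j i)
  have hAU : ∀ i, disjointed A i ⊆ U := fun i =>
    (disjointed_subset A i).trans (prefixInterior_subset U _)
  refine ⟨disjointed A, fun i => ?_, fun i => ?_, ?_⟩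
  · exact disjointedRec (fun _ _ ht => ht.diff (isClopen_prefixInterior U _))
      (isClopen_prefixInterior U _)
  · cases i with
    | zero => exact (measure_mono (hAU 0)).trans hUε.le
    | succ i =>
      have hsub : disjointed A (i + 1) ⊆ U \ A i := fun x hx =>
        ⟨hAU _ hx, by
          rw [disjointed_eq_inter_compl] at hx
          exact mem_iInter₂.1 hx.2 i i.lt_succ_self⟩
      exact (measure_mono hsub).trans (hj i).le
  · rw [iUnion_disjointed]
    refine hBU.trans (hU.iUnion_prefixInterior.ge.trans ?_)
    exact iUnion_mono fun i => monotone_prefixInterior U (hij i)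

/-- Every set `X ⊆ 2^ω` contained in a Borel set of `μ`-measure zero
is covered by `H_f = ⋂_{N} ⋃_{n > N} C^n_{f n}` for some `f : ℕ → ℕ`. -/
theorem statement1
    (μ : Measure (ℕ → Bool))
    (hμ : ∀ (s : Finset ℕ) (σ : ℕ → Bool),
      μ {x : ℕ → Bool | ∀ i ∈ s, x i = σ i} = (2 : ENNReal)⁻¹ ^ s.card)
    (h : ℕ → ℕ) (hmono : StrictMono h)
    (hgrow : ∀ n : ℕ, 1 ≤ n → (n + 1 : ℕ) ≤ 2 ^ (h n - h (n - 1)))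
    (C : ℕ → ℕ → Set (ℕ → Bool))
    (hclopen : ∀ n i, IsClopen (C n i))
    (hmeas : ∀ n i, μ (C n i) = (2 : ENNReal)⁻¹ ^ h n)
    (hsurj : ∀ (n : ℕ) (U : Set (ℕ → Bool)),
      IsClopen U → μ U = (2 : ENNReal)⁻¹ ^ h n → ∃ i, C n i = U)
    (X B : Set (ℕ → Bool)) (hB : MeasurableSet B) (hB0 : μ B = 0) (hXB : X ⊆ B) :
    ∃ f : ℕ → ℕ, X ⊆ ⋂ N : ℕ, ⋃ n > N, C n (f n) := by
  have : IsFiniteMeasure μ := ⟨by simpa using (hμ ∅ fun _ => false).trans_lt (by simp)⟩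
  choose K hK hKle hBK using fun k => exists_isClopen_cover_of_measure_zero hB0
    (ε := fun i => (2 : ENNReal)⁻¹ ^ h (Nat.pair k i)) fun i => ENNReal.pow_pos (by simp) _
  have hf : ∀ n, ∃ i, K n.unpair.1 n.unpair.2 ⊆ C n i := fun n => by
    obtain ⟨U, hU, hKU, hUm⟩ := (hK n.unpair.1 n.unpair.2).exists_superset_measure_eq hμ
      (m := h n) (by simpa using hKle n.unpair.1 n.unpair.2)
    obtain ⟨i, rfl⟩ := hsurj n U hU hUm
    exact ⟨i, hKU⟩
  choose f hf using hf
  refine ⟨f, fun x hx => mem_iInter.2 fun N => ?_⟩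
  obtain ⟨i, hi⟩ := mem_iUnion.1 (hBK (N + 1) (hXB hx))
  refine mem_iUnion₂.2 ⟨Nat.pair (N + 1) i, Nat.left_le_pair (N + 1) i, hf _ ?_⟩
  simpa using hi
end

section
/- For every slalom φ, the set H_φ = ⋂_{N<ω} ⋃_{n>N} ⋃_{i∈φ(n)} C^n_i is a Gδ subset of 2^ω of measure zero. -/
open MeasureTheory Set

/-- A `limsup` of sets with `μ (s n) ≤ n * 2⁻¹ ^ n` is a null set. -/
theorem measure_iInter_iUnion_gt_eq_zero {α : Type*} [MeasurableSpace α] (μ : Measure α)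
    (s : ℕ → Set α) (hs : ∀ n, μ (s n) ≤ n * (2 : ENNReal)⁻¹ ^ n) :
    μ (⋂ N : ℕ, ⋃ n > N, s n) = 0 := by
  have hsum : Summable fun n : ℕ => (n : ℝ) * (2 : ℝ)⁻¹ ^ n := by
    simpa using summable_pow_mul_geometric_of_norm_lt_one (R := ℝ) 1 (r := 2⁻¹) (by norm_num)
  have hfin : ∑' n, μ (s n) ≠ ⊤ := by
    refine ne_top_of_le_ne_top hsum.tsum_ofReal_ne_top (ENNReal.tsum_le_tsum fun n => ?_)
    rw [ENNReal.ofReal_mul n.cast_nonneg, ENNReal.ofReal_natCast,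
      ENNReal.ofReal_pow (by norm_num), ENNReal.ofReal_inv_of_pos two_pos, ENNReal.ofReal_ofNat]
    exact hs n
  refine measure_mono_null ?_ (measure_limsup_atTop_eq_zero hfin)
  rw [Filter.limsup_eq_iInf_iSup_of_nat]
  exact iInter_mono fun N => iUnion_mono fun n => iUnion_mono' fun hn => ⟨le_of_lt hn, le_rfl⟩

/-- For every slalom `φ` (i.e. `φ : ℕ → Finset ℕ` with `|φ n| ≤ n`),
the set `H_φ = ⋂_{N} ⋃_{n > N} ⋃_{i ∈ φ n} C^n_i` is a Gδ subset of `2^ω` of measure zero. -/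
theorem statement2
    (μ : Measure (ℕ → Bool))
    (hμ : ∀ (s : Finset ℕ) (σ : ℕ → Bool),
      μ {x : ℕ → Bool | ∀ i ∈ s, x i = σ i} = (2 : ENNReal)⁻¹ ^ s.card)
    (h : ℕ → ℕ) (hmono : StrictMono h)
    (hgrow : ∀ n : ℕ, 1 ≤ n → (n + 1 : ℕ) ≤ 2 ^ (h n - h (n - 1)))
    (C : ℕ → ℕ → Set (ℕ → Bool))
    (hclopen : ∀ n i, IsClopen (C n i))
    (hmeas : ∀ n i, μ (C n i) = (2 : ENNReal)⁻¹ ^ h n)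
    (hsurj : ∀ (n : ℕ) (U : Set (ℕ → Bool)),
      IsClopen U → μ U = (2 : ENNReal)⁻¹ ^ h n → ∃ i, C n i = U)
    (φ : ℕ → Finset ℕ) (hφ : ∀ n, (φ n).card ≤ n) :
    IsGδ (⋂ N : ℕ, ⋃ n > N, ⋃ i ∈ φ n, C n i) ∧
    μ (⋂ N : ℕ, ⋃ n > N, ⋃ i ∈ φ n, C n i) = 0 := by
  refine ⟨.iInter_of_isOpen fun N => isOpen_biUnion fun n _ => isOpen_biUnion fun i _ =>
    (hclopen n i).isOpen, measure_iInter_iUnion_gt_eq_zero μ _ fun n => ?_⟩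
  calc μ (⋃ i ∈ φ n, C n i) ≤ ∑ i ∈ φ n, μ (C n i) := measure_biUnion_finset_le _ _
    _ = (φ n).card * (2 : ENNReal)⁻¹ ^ h n := by simp [hmeas]
    _ ≤ n * (2 : ENNReal)⁻¹ ^ n :=
      mul_le_mul' (by exact_mod_cast hφ n) (pow_le_pow_right_of_le_one' (by simp) hmono.le_apply)
end

section
/- For every slalom φ there exists a selector for φ, i.e., a function r : ℕ → ℕ with r(0) = 0 such that for every n ≥ 1, C^n_{r(n)} ⊆ C^{n-1}_{r(n-1)} \ ⋃_{j∈φ(n)} C^n_j. -/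
open MeasureTheory Set

/-- A compact open subset of the Cantor space is determined by finitely many coordinates. -/
lemma exists_forall_mem_of_eq_below {U : Set (ℕ → Bool)} (hU : IsClopen U) :
    ∃ N : ℕ, ∀ x ∈ U, ∀ y : ℕ → Bool, (∀ i < N, y i = x i) → y ∈ U := by
  have hex : ∀ x ∈ U, ∃ n, PiNat.cylinder x n ⊆ U := by
    intro x hx
    obtain ⟨v, ⟨z, n, rfl⟩, hxv, hvU⟩ :=
      (PiNat.isTopologicalBasis_cylinders (fun _ : ℕ => Bool)).exists_subset_of_mem_open hx
        hU.isOpen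
    exact ⟨n, (PiNat.mem_cylinder_iff_eq.1 hxv).trans_subset hvU⟩
  choose! n hn using hex
  obtain ⟨t, htU, ht⟩ := hU.isClosed.isCompact.elim_nhds_subcover (fun x => PiNat.cylinder x (n x))
    (fun x _ => (PiNat.isOpen_cylinder _ x (n x)).mem_nhds (PiNat.self_mem_cylinder x (n x)))
  refine ⟨t.sup n, fun x hx y hxy => ?_⟩
  obtain ⟨z, hz, hxz⟩ := mem_iUnion₂.1 (ht hx)
  refine hn z (htU z hz) fun i hi => ?_
  rw [hxy i (hi.trans_le (Finset.le_sup hz)), hxz i hi]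

/-- The measure of a set determined by its restrictions to the first `N` coordinates. -/
lemma measure_preimage_restrict_fin {μ : Measure (ℕ → Bool)}
    (hμ : ∀ (s : Finset ℕ) (σ : ℕ → Bool),
      μ {x : ℕ → Bool | ∀ i ∈ s, x i = σ i} = (2 : ENNReal)⁻¹ ^ s.card)
    (N : ℕ) (T : Finset (Fin N → Bool)) :
    μ ((fun (x : ℕ → Bool) (i : Fin N) => x i) ⁻¹' T) = T.card * (2 : ENNReal)⁻¹ ^ N := by
  have hmeas : Measurable (fun (x : ℕ → Bool) (i : Fin N) => x i) := by fun_prop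
  rw [← sum_measure_preimage_singleton T fun y _ => hmeas (measurableSet_singleton y),
    ← nsmul_eq_mul]
  refine Finset.sum_eq_card_nsmul fun t _ => ?_
  have key := hμ (Finset.range N) fun i => if hi : i < N then t ⟨i, hi⟩ else false
  rw [Finset.card_range] at key
  rw [← key]
  congr 1
  ext x
  simp only [mem_preimage, mem_singleton_iff, funext_iff, Finset.mem_range, mem_ofPred_eq]
  constructor
  · intro hx i hi
    simpa [hi] using hx ⟨i, hi⟩
  · intro hx i
    simpa using hx i i.2

/-- A clopen set of measure at least `2⁻ᵐ` has a clopen subset of measure exactly `2⁻ᵐ`. -/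
lemma exists_isClopen_subset_measure_eq {μ : Measure (ℕ → Bool)}
    (hμ : ∀ (s : Finset ℕ) (σ : ℕ → Bool),
      μ {x : ℕ → Bool | ∀ i ∈ s, x i = σ i} = (2 : ENNReal)⁻¹ ^ s.card)
    {U : Set (ℕ → Bool)} (hU : IsClopen U) {m : ℕ} (hm : (2 : ENNReal)⁻¹ ^ m ≤ μ U) :
    ∃ V ⊆ U, IsClopen V ∧ μ V = (2 : ENNReal)⁻¹ ^ m := by
  classical
  obtain ⟨N₀, hN₀⟩ := exists_forall_mem_of_eq_below hU
  obtain ⟨k, hk⟩ : ∃ k, N₀ ≤ m + k := ⟨N₀, by omega⟩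
  let f : (ℕ → Bool) → (Fin (m + k) → Bool) := fun x i => x i
  have hf : Continuous f := by fun_prop
  let T : Finset (Fin (m + k) → Bool) := (f '' U).toFinset
  have hT : f ⁻¹' T = U := by
    ext y
    simp only [T, coe_toFinset, mem_preimage, mem_image]
    refine ⟨?_, fun hy => ⟨y, hy, rfl⟩⟩
    rintro ⟨x, hx, hxy⟩
    exact hN₀ x hx y fun i hi => (congrFun hxy ⟨i, hi.trans_le hk⟩).symm
  have hpow : (2 : ENNReal)⁻¹ ^ m = ((2 ^ k : ℕ) : ENNReal) * (2 : ENNReal)⁻¹ ^ (m + k) := by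
    rw [pow_add, mul_left_comm, Nat.cast_pow, Nat.cast_ofNat, ← mul_pow,
      ENNReal.mul_inv_cancel (by simp) (by simp), one_pow, mul_one]
  have hcard : 2 ^ k ≤ T.card := by
    rw [← hT, measure_preimage_restrict_fin hμ, hpow,
      ENNReal.mul_le_mul_iff_left (by simp) (by simp)] at hm
    exact_mod_cast hm
  obtain ⟨S, hST, hS⟩ := Finset.exists_subset_card_eq hcard
  refine ⟨f ⁻¹' S, ?_, (isClopen_discrete _).preimage hf, ?_⟩
  · rw [← hT]
    exact preimage_mono (Finset.coe_subset.2 hST)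
  · rw [measure_preimage_restrict_fin hμ, hS, hpow]

/-- For every slalom `φ` there exists a selector for `φ`: a function
`r : ℕ → ℕ` with `r 0 = 0` such that for every `n ≥ 1`,
`C^n_{r n} ⊆ C^{n-1}_{r (n-1)} \ ⋃_{j ∈ φ n} C^n_j`.  (Here `h 0 = 0` is part of the
context.) -/
theorem statement6
    (μ : Measure (ℕ → Bool))
    (hμ : ∀ (s : Finset ℕ) (σ : ℕ → Bool),
      μ {x : ℕ → Bool | ∀ i ∈ s, x i = σ i} = (2 : ENNReal)⁻¹ ^ s.card)
    (h : ℕ → ℕ) (hmono : StrictMono h) (h0 : h 0 = 0)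
    (hgrow : ∀ n : ℕ, 1 ≤ n → (n + 1 : ℕ) ≤ 2 ^ (h n - h (n - 1)))
    (C : ℕ → ℕ → Set (ℕ → Bool))
    (hclopen : ∀ n i, IsClopen (C n i))
    (hmeas : ∀ n i, μ (C n i) = (2 : ENNReal)⁻¹ ^ h n)
    (hsurj : ∀ (n : ℕ) (U : Set (ℕ → Bool)),
      IsClopen U → μ U = (2 : ENNReal)⁻¹ ^ h n → ∃ i, C n i = U)
    (φ : ℕ → Finset ℕ) (hφ : ∀ n, (φ n).card ≤ n) :
    ∃ r : ℕ → ℕ, r 0 = 0 ∧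
      ∀ n : ℕ, 1 ≤ n → C n (r n) ⊆ C (n - 1) (r (n - 1)) \ ⋃ j ∈ φ n, C n j := by
  have step : ∀ n i, ∃ j, C (n + 1) j ⊆ C n i \ ⋃ j ∈ φ (n + 1), C (n + 1) j := by
    intro n i
    have hB : IsClopen (⋃ j ∈ φ (n + 1), C (n + 1) j) :=
      isClopen_biUnion_finset fun j _ => hclopen _ j
    have hBμ : μ (⋃ j ∈ φ (n + 1), C (n + 1) j) ≤
        ((n + 1 : ℕ) : ENNReal) * (2 : ENNReal)⁻¹ ^ h (n + 1) := by
      refine (measure_biUnion_finset_le _ _).trans ?_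
      simp only [hmeas, Finset.sum_const, nsmul_eq_mul]
      gcongr
      exact hφ _
    have hle : (2 : ENNReal)⁻¹ ^ h (n + 1) ≤ μ (C n i \ ⋃ j ∈ φ (n + 1), C (n + 1) j) := by
      refine le_trans ?_ le_measure_sdiff
      refine le_trans ?_ (tsub_le_tsub_left hBμ _)
      refine ENNReal.le_sub_of_add_le_right
        (ENNReal.mul_ne_top (ENNReal.natCast_ne_top _) (by simp)) ?_
      obtain ⟨d, hd⟩ := Nat.exists_eq_add_of_le (hmono n.lt_succ_self).le
      have hg := hgrow (n + 1) (by omega)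
      rw [Nat.add_sub_cancel, show h (n + 1) - h n = d by grind] at hg
      calc (2 : ENNReal)⁻¹ ^ h (n + 1) + ((n + 1 : ℕ) : ENNReal) * (2 : ENNReal)⁻¹ ^ h (n + 1)
          = ((n + 1 + 1 : ℕ) : ENNReal) * (2 : ENNReal)⁻¹ ^ h (n + 1) := by push_cast; ring
        _ ≤ ((2 ^ d : ℕ) : ENNReal) * (2 : ENNReal)⁻¹ ^ h (n + 1) := by gcongr
        _ = μ (C n i) := by
          rw [hmeas, show h (n + 1) = h n + d from hd, pow_add, mul_left_comm, Nat.cast_pow,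
            Nat.cast_ofNat, ← mul_pow, ENNReal.mul_inv_cancel (by simp) (by simp), one_pow,
            mul_one]
    obtain ⟨V, hVU, hV, hVμ⟩ :=
      exists_isClopen_subset_measure_eq hμ ((hclopen n i).diff hB) hle
    obtain ⟨j, rfl⟩ := hsurj _ V hV hVμ
    exact ⟨j, hVU⟩
  choose next hnext using step
  refine ⟨fun n => Nat.rec 0 next n, rfl, fun n hn => ?_⟩
  obtain ⟨n, rfl⟩ := Nat.exists_eq_add_of_le' hn
  exact hnext n _
end

section
/- Let φ and ψ be slaloms and let r be a selector for φ. If r(n) ∈ ψ(n) for infinitely many n < ω, then ⋂_{n<ω} C^n_{r(n)} ⊆ H_ψ, and consequently H_ψ is not a subset of H_φ. -/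
open MeasureTheory Set

/-- Let `φ`, `ψ` be slaloms and `r` a selector for `φ`.  If
`r n ∈ ψ n` for infinitely many `n`, then `⋂_{n} C^n_{r n} ⊆ H_ψ`, and consequently
`H_ψ` is not a subset of `H_φ`. -/
theorem statement9
    (μ : Measure (ℕ → Bool))
    (hμ : ∀ (s : Finset ℕ) (σ : ℕ → Bool),
      μ {x : ℕ → Bool | ∀ i ∈ s, x i = σ i} = (2 : ENNReal)⁻¹ ^ s.card)
    (h : ℕ → ℕ) (hmono : StrictMono h)
    (hgrow : ∀ n : ℕ, 1 ≤ n → (n + 1 : ℕ) ≤ 2 ^ (h n - h (n - 1)))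
    (C : ℕ → ℕ → Set (ℕ → Bool))
    (hclopen : ∀ n i, IsClopen (C n i))
    (hmeas : ∀ n i, μ (C n i) = (2 : ENNReal)⁻¹ ^ h n)
    (hsurj : ∀ (n : ℕ) (U : Set (ℕ → Bool)),
      IsClopen U → μ U = (2 : ENNReal)⁻¹ ^ h n → ∃ i, C n i = U)
    (φ ψ : ℕ → Finset ℕ) (hφ : ∀ n, (φ n).card ≤ n) (hψ : ∀ n, (ψ n).card ≤ n)
    (r : ℕ → ℕ) (hr0 : r 0 = 0)
    (hr : ∀ n : ℕ, 1 ≤ n → C n (r n) ⊆ C (n - 1) (r (n - 1)) \ ⋃ j ∈ φ n, C n j)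
    (hinf : ∀ N : ℕ, ∃ n > N, r n ∈ ψ n) :
    (⋂ n : ℕ, C n (r n)) ⊆ (⋂ N : ℕ, ⋃ n > N, ⋃ i ∈ ψ n, C n i) ∧
    ¬ (⋂ N : ℕ, ⋃ n > N, ⋃ i ∈ ψ n, C n i) ⊆ (⋂ N : ℕ, ⋃ n > N, ⋃ i ∈ φ n, C n i) := by
  have hanti : ∀ n, C (n + 1) (r (n + 1)) ⊆ C n (r n) := fun n =>
    (hr (n + 1) (by omega)).trans sdiff_subset
  have hne : ∀ n, (C n (r n)).Nonempty := fun n =>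
    nonempty_of_measure_ne_zero (μ := μ) (by simp [hmeas])
  obtain ⟨x, hx⟩ : (⋂ n, C n (r n)).Nonempty :=
    IsCompact.nonempty_iInter_of_sequence_nonempty_isCompact_isClosed _ hanti hne
      (hclopen 0 (r 0)).isClosed.isCompact fun n => (hclopen n (r n)).isClosed
  have hsub : (⋂ n, C n (r n)) ⊆ ⋂ N : ℕ, ⋃ n > N, ⋃ i ∈ ψ n, C n i := by
    intro y hy
    refine mem_iInter.2 fun N => ?_
    obtain ⟨n, hnN, hn⟩ := hinf N
    exact mem_iUnion₂.2 ⟨n, hnN, mem_iUnion₂.2 ⟨r n, hn, mem_iInter.1 hy n⟩⟩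
  refine ⟨hsub, fun hψφ => ?_⟩
  obtain ⟨n, hn, hxn⟩ := mem_iUnion₂.1 (mem_iInter.1 (hψφ (hsub hx)) 0)
  exact (hr n hn (mem_iInter.1 hx n)).2 hxn
end

section
/- The localization forcing LOC is σ-linked, and consequently it satisfies the countable chain condition. -/
/-- A condition of the localization forcing `LOC`: a pair `(s, F)` where `s ∈ 𝒯`
(a finite sequence of finite sets with `|s i| ≤ i`) and `F` is a finite set of functions
`ℕ → ℕ` with `|F| ≤ |s|`. -/
structure LOCCond where
  s : List (Finset ℕ)
  F : Finset (ℕ → ℕ)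
  card_le : ∀ i, i < s.length → (s.getD i ∅).card ≤ i
  F_card_le : F.card ≤ s.length

/-- The extension relation of `LOC`: `p` extends `q` iff `s^p` end-extends `s^q`,
`F^p ⊇ F^q`, and for every `n` with `|s^q| ≤ n < |s^p|` and every `f ∈ F^q`,
`f n ∈ s^p n`. -/
def LOCCond.le (p q : LOCCond) : Prop :=
  q.s <+: p.s ∧ q.F ⊆ p.F ∧
    ∀ n, q.s.length ≤ n → n < p.s.length → ∀ f ∈ q.F, f n ∈ p.s.getD n ∅

/-- Two conditions are compatible iff they have a common extension. -/
def LOCCond.Compatible (p q : LOCCond) : Prop :=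
  ∃ r : LOCCond, r.le p ∧ r.le q

namespace LOCCond

/-- The end-extension of `p.s` to length `2 * p.s.length` whose new entry at `n` is the set of
values at `n` of the functions in `p.F`. -/
def double (p : LOCCond) : List (Finset ℕ) :=
  p.s ++ (List.range p.s.length).map fun i => p.F.image fun f => f (p.s.length + i)

lemma length_double (p : LOCCond) : p.double.length = 2 * p.s.length := by
  simp [double, two_mul]

lemma prefix_double (p : LOCCond) : p.s <+: p.double :=
  List.prefix_append _ _

lemma getD_double_of_lt (p : LOCCond) {n : ℕ} (h : n < p.s.length) :
    p.double.getD n ∅ = p.s.getD n ∅ :=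
  List.getD_append _ _ _ _ h

lemma getD_double_of_le (p : LOCCond) {n : ℕ} (h : p.s.length ≤ n) (h' : n < p.double.length) :
    p.double.getD n ∅ = p.F.image fun f => f n := by
  obtain ⟨k, rfl⟩ := Nat.exists_eq_add_of_le h
  rw [length_double] at h'
  have hk : k < p.s.length := by omega
  rw [double, List.getD_append_right _ _ _ _ h, List.getD_eq_getElem _ _ (by simpa using hk)]
  simp

lemma card_getD_double_le (p : LOCCond) {n : ℕ} (h : n < p.double.length) :
    (p.double.getD n ∅).card ≤ n := by
  rcases lt_or_ge n p.s.length with hn | hn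
  · rw [getD_double_of_lt p hn]
    exact p.card_le n hn
  · rw [getD_double_of_le p hn h]
    exact Finset.card_image_le.trans (p.F_card_le.trans hn)

lemma le_of_s_eq_double {r p : LOCCond} (hs : r.s = p.double) (hF : p.F ⊆ r.F) : r.le p := by
  refine ⟨hs ▸ p.prefix_double, hF, fun n hn hn' f hf => ?_⟩
  rw [hs] at hn' ⊢
  rw [getD_double_of_le p hn hn']
  exact Finset.mem_image_of_mem (fun f => f n) hf

open Classical in
lemma compatible_of_double_eq {p q : LOCCond} (h : p.double = q.double) : p.Compatible q := by
  have hlen : p.s.length = q.s.length := by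
    have := congrArg List.length h
    rw [length_double, length_double] at this
    omega
  have hcard : (p.F ∪ q.F).card ≤ p.double.length := by
    have := Finset.card_union_le p.F q.F
    have := p.F_card_le
    have := q.F_card_le
    rw [length_double]
    omega
  exact ⟨⟨p.double, p.F ∪ q.F, fun _ => p.card_getD_double_le, hcard⟩,
    le_of_s_eq_double rfl Finset.subset_union_left,
    le_of_s_eq_double h Finset.subset_union_right⟩

end LOCCond

/-- The localization forcing `LOC` is σ-linked (a countable union of
pairwise-compatible pieces), and consequently it satisfies the countable chain condition
(every pairwise-incompatible set of conditions is countable). -/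
theorem statement12 :
    (∃ L : ℕ → Set LOCCond, (∀ p : LOCCond, ∃ n, p ∈ L n) ∧
      ∀ n, ∀ p ∈ L n, ∀ q ∈ L n, p.Compatible q) ∧
    (∀ A : Set LOCCond,
      (∀ p ∈ A, ∀ q ∈ A, p ≠ q → ¬ p.Compatible q) → A.Countable) := by
  refine ⟨⟨fun n => {p | Encodable.encode p.double = n}, fun p => ⟨_, rfl⟩, ?_⟩, fun A hA => ?_⟩
  · intro n p hp q hq
    exact LOCCond.compatible_of_double_eq (Encodable.encode_injective (hp.trans hq.symm))
  · have hinj : Set.InjOn LOCCond.double A := fun p hp q hq h => by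
      by_contra hne
      exact hA p hp q hq hne (LOCCond.compatible_of_double_eq h)
    exact Set.countable_of_injective_of_countable_image hinj (Set.to_countable _)
end

section
/- For each function f : ℕ → ℕ, the set {q ∈ LOC* : f ∈ F^q} is dense in LOC*. In fact, for any condition p = (s^p, w^p, F^p) of LOC*, the triple q = (s^q, w^p + 1, F^p ∪ {f}), where s^q is the sequence of length |s^p| + 1 extending s^p with s^q(|s^p|) = {g(|s^p|) : g ∈ F^p}, is a condition of LOC* extending p. -/
/-- A condition of the modified localization forcing `LOC*`: a triple `(s, w, F)` where
`s ∈ 𝒯` (a finite sequence of finite sets with `|s i| ≤ i`), `w` is a natural number and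
`F` is a finite set of functions `ℕ → ℕ` with `|F| ≤ w ≤ |s|`. -/
structure LOCStarCond where
  s : List (Finset ℕ)
  w : ℕ
  F : Finset (ℕ → ℕ)
  card_le : ∀ i, i < s.length → (s.getD i ∅).card ≤ i
  F_card_le : F.card ≤ w
  w_le : w ≤ s.length

/-- The extension relation of `LOC*`: `p` extends `q` iff (i) `s^p` end-extends `s^q`,
`w^p ≥ w^q`, `F^p ⊇ F^q`, and for every `n` with `|s^q| ≤ n < |s^p|` and every `f ∈ F^q`
we have `f n ∈ s^p n`; (ii) `w^p ≤ w^q + (|s^p| − |s^q|)`; and (iii) for every `n` with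
`|s^q| ≤ n < |s^p|`, `|s^p n| ≤ w^q + (n − |s^q|)`. -/
def LOCStarCond.le (p q : LOCStarCond) : Prop :=
  (q.s <+: p.s ∧ q.w ≤ p.w ∧ q.F ⊆ p.F ∧
    ∀ n, q.s.length ≤ n → n < p.s.length → ∀ f ∈ q.F, f n ∈ p.s.getD n ∅) ∧
  p.w ≤ q.w + (p.s.length - q.s.length) ∧
  ∀ n, q.s.length ≤ n → n < p.s.length →
    (p.s.getD n ∅).card ≤ q.w + (n - q.s.length)

namespace LOCStarCond

theorem card_image_eval_le (p : LOCStarCond) (n : ℕ) :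
    (p.F.image (fun g => g n)).card ≤ p.w :=
  Finset.card_image_le.trans p.F_card_le

open Classical in
/-- The one-step extension of `p` that adds `f` to the set of promised functions. -/
noncomputable def addFun (p : LOCStarCond) (f : ℕ → ℕ) : LOCStarCond where
  s := p.s ++ [p.F.image (fun g => g p.s.length)]
  w := p.w + 1
  F := insert f p.F
  card_le := by
    intro i hi
    rcases Nat.lt_or_ge i p.s.length with h | h
    · rw [List.getD_append _ _ _ _ h]
      exact p.card_le i h
    · obtain rfl : i = p.s.length := by
        simp only [List.length_append, List.length_singleton] at hi
        omega
      simpa using (p.card_image_eval_le p.s.length).trans p.w_le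
  F_card_le := (Finset.card_insert_le _ _).trans (Nat.succ_le_succ p.F_card_le)
  w_le := by simpa using p.w_le

theorem mem_addFun_F (p : LOCStarCond) (f g : ℕ → ℕ) :
    g ∈ (p.addFun f).F ↔ g = f ∨ g ∈ p.F := by
  simp [addFun]

theorem addFun_le (p : LOCStarCond) (f : ℕ → ℕ) : (p.addFun f).le p := by
  have eq_length : ∀ n, p.s.length ≤ n → n < (p.addFun f).s.length → n = p.s.length := by
    intro n h₁ h₂
    simp only [addFun, List.length_append, List.length_singleton] at h₂
    omega
  refine ⟨⟨List.prefix_append _ _, Nat.le_succ _, fun g hg => ?_, fun n h₁ h₂ g hg => ?_⟩,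
    ?_, fun n h₁ h₂ => ?_⟩
  · exact (p.mem_addFun_F f g).2 (Or.inr hg)
  · obtain rfl := eq_length n h₁ h₂
    simpa [addFun] using ⟨g, hg, rfl⟩
  · simp [addFun]
  · obtain rfl := eq_length n h₁ h₂
    simpa [addFun] using p.card_image_eval_le p.s.length

end LOCStarCond

/-- For each `f : ℕ → ℕ`, the set `{q ∈ LOC* : f ∈ F^q}` is dense in
`LOC*`.  In fact, for any condition `p` the triple `q` with
`s^q = s^p ⌢ ⟨{g(|s^p|) : g ∈ F^p}⟩`, `w^q = w^p + 1` and `F^q = F^p ∪ {f}` is a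
condition of `LOC*` extending `p`. -/
theorem statement14 (f : ℕ → ℕ) :
    (∀ p : LOCStarCond, ∃ q : LOCStarCond, q.le p ∧ f ∈ q.F) ∧
    (∀ p : LOCStarCond, ∃ q : LOCStarCond,
      q.s = p.s ++ [p.F.image (fun g => g p.s.length)] ∧
      q.w = p.w + 1 ∧
      (∀ g : ℕ → ℕ, g ∈ q.F ↔ g = f ∨ g ∈ p.F) ∧
      q.le p) := by
  exact ⟨fun p => ⟨p.addFun f, p.addFun_le f, (p.mem_addFun_F f f).2 (Or.inl rfl)⟩,
    fun p => ⟨p.addFun f, rfl, rfl, p.mem_addFun_F f, p.addFun_le f⟩⟩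
end

section
/- The modified localization forcing LOC* is σ-linked, and consequently it satisfies the countable chain condition. Moreover, the set L = {p ∈ LOC* : w^p ≥ 2·|F^p|} is dense in LOC*, and for each fixed s ∈ 𝒯 and w ≤ |s|, any two conditions in {p ∈ L : s^p = s and w^p = w} are compatible. -/
/-- Two conditions of `LOC*` are compatible iff they have a common extension. -/
def LOCStarCond.Compatible (p q : LOCStarCond) : Prop :=
  ∃ r : LOCStarCond, r.le p ∧ r.le q

namespace LOCStarCond

theorem le.trans {p q r : LOCStarCond} (hpq : p.le q) (hqr : q.le r) : p.le r := by
  obtain ⟨⟨hs, hw, hF, hmem⟩, hw', hcard⟩ := hpq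
  obtain ⟨⟨hs₂, hw₂, hF₂, hmem₂⟩, hw₂', hcard₂⟩ := hqr
  have hlen := hs.length_le
  have hlen₂ := hs₂.length_le
  have hgetD : ∀ n, n < q.s.length → p.s.getD n ∅ = q.s.getD n ∅ := by
    intro n hn
    obtain ⟨t, ht⟩ := hs
    rw [← ht, List.getD_append _ _ _ _ hn]
  refine ⟨⟨hs₂.trans hs, hw₂.trans hw, hF₂.trans hF, fun n hn hn' f hf => ?_⟩, by omega,
    fun n hn hn' => ?_⟩
  · rcases lt_or_ge n q.s.length with h | h
    · rw [hgetD n h]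
      exact hmem₂ n hn h f hf
    · exact hmem n h hn' f (hF₂ hf)
  · rcases lt_or_ge n q.s.length with h | h
    · rw [hgetD n h]
      exact hcard₂ n hn h
    · have := hcard n h hn'
      omega

theorem Compatible.of_le {p q p' q' : LOCStarCond} (h : p'.Compatible q') (hp : p'.le p)
    (hq : q'.le q) : p.Compatible q :=
  let ⟨r, hrp, hrq⟩ := h
  ⟨r, hrp.trans hp, hrq.trans hq⟩

/-- Every condition `p` is extended by one of width `2 * p.w` with the same set of functions: append
`p.w` many sets, each consisting of the values of the functions in `p.F`. -/
theorem exists_le_two_mul_card_le (p : LOCStarCond) :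
    ∃ q : LOCStarCond, q.le p ∧ 2 * q.F.card ≤ q.w := by
  set t : List (Finset ℕ) := List.ofFn fun i : Fin p.w => p.F.image fun f => f (p.s.length + i)
    with ht
  have htlen : t.length = p.w := by simp [ht]
  have hFw := p.F_card_le
  have hws := p.w_le
  have hgetD : ∀ n, p.s.length ≤ n → n < (p.s ++ t).length →
      (p.s ++ t).getD n ∅ = p.F.image fun f => f n := by
    intro n hn hn'
    rw [List.length_append] at hn'
    rw [List.getD_append_right _ _ _ _ hn, List.getD_eq_getElem _ _ (by omega)]
    simp [ht, Nat.add_sub_cancel' hn]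
  have hcard : ∀ n, p.s.length ≤ n → n < (p.s ++ t).length →
      ((p.s ++ t).getD n ∅).card ≤ p.w := by
    intro n hn hn'
    rw [hgetD n hn hn']
    exact Finset.card_image_le.trans hFw
  refine ⟨⟨p.s ++ t, p.w + p.w, p.F, fun i hi => ?_, by omega, ?_⟩,
    ⟨⟨List.prefix_append _ _, Nat.le_add_right _ _, subset_rfl, fun n hn hn' f hf => ?_⟩, ?_,
      fun n hn hn' => (hcard n hn hn').trans (Nat.le_add_right _ _)⟩, ?_⟩
  · rcases lt_or_ge i p.s.length with h | h
    · rw [List.getD_append _ _ _ _ h]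
      exact p.card_le i h
    · exact (hcard i h hi).trans (hws.trans h)
  · rw [List.length_append]
    omega
  · simp only at hn' ⊢
    rw [hgetD n hn hn']
    exact Finset.mem_image_of_mem _ hf
  · simp [htlen]
  · simp only
    omega

theorem compatible_of_two_mul_card_le {p q : LOCStarCond} (hp : 2 * p.F.card ≤ p.w)
    (hq : 2 * q.F.card ≤ q.w) (hs : p.s = q.s) (hw : p.w = q.w) : p.Compatible q := by
  classical
  have hcard := Finset.card_union_le p.F q.F
  refine ⟨⟨p.s, p.w, p.F ∪ q.F, p.card_le, by omega, p.w_le⟩, ?_, ?_⟩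
  · exact ⟨⟨List.prefix_rfl, le_rfl, Finset.subset_union_left, fun n hn hn' => by
      simp only at hn'; omega⟩, Nat.le_add_right _ _, fun n hn hn' => by simp only at hn'; omega⟩
  · exact ⟨⟨hs ▸ List.prefix_rfl, hw.ge, Finset.subset_union_right, fun n hn hn' => by
      simp only [hs] at hn'; omega⟩, hw.le.trans (Nat.le_add_right _ _), fun n hn hn' => by
        simp only [hs] at hn'; omega⟩

theorem exists_linked_cover :
    ∃ L : ℕ → Set LOCStarCond, (∀ p : LOCStarCond, ∃ n, p ∈ L n) ∧
      ∀ n, ∀ p ∈ L n, ∀ q ∈ L n, p.Compatible q := by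
  choose g hg hgL using exists_le_two_mul_card_le
  refine ⟨fun n => {p | Encodable.encode ((g p).s, (g p).w) = n}, fun p => ⟨_, rfl⟩, ?_⟩
  rintro n p hp q hq
  have h := Encodable.encode_injective (hp.trans hq.symm)
  rw [Prod.mk.injEq] at h
  exact (compatible_of_two_mul_card_le (hgL p) (hgL q) h.1 h.2).of_le (hg p) (hg q)

theorem countable_of_antichain {A : Set LOCStarCond}
    (hA : ∀ p ∈ A, ∀ q ∈ A, p ≠ q → ¬ p.Compatible q) : A.Countable := by
  obtain ⟨L, hcover, hL⟩ := exists_linked_cover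
  choose c hc using hcover
  refine Set.MapsTo.countable_of_injOn (Set.mapsTo_univ c A) (fun p hp q hq hpq => ?_)
    Set.countable_univ
  by_contra hne
  exact hA p hp q hq hne (hL _ p (hc p) q (hpq ▸ hc q))

end LOCStarCond

/-- `LOC*` is σ-linked, hence ccc.  Moreover the set
`L = {p : w^p ≥ 2·|F^p|}` is dense in `LOC*`, and for fixed `s` and `w` any two
conditions in `L` with stem `s` and width `w` are compatible. -/
theorem statement15 :
    (∀ p : LOCStarCond, ∃ q : LOCStarCond, q.le p ∧ 2 * q.F.card ≤ q.w) ∧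
    (∀ p q : LOCStarCond, 2 * p.F.card ≤ p.w → 2 * q.F.card ≤ q.w →
      p.s = q.s → p.w = q.w → p.Compatible q) ∧
    (∃ L : ℕ → Set LOCStarCond, (∀ p : LOCStarCond, ∃ n, p ∈ L n) ∧
      ∀ n, ∀ p ∈ L n, ∀ q ∈ L n, p.Compatible q) ∧
    (∀ A : Set LOCStarCond,
      (∀ p ∈ A, ∀ q ∈ A, p ≠ q → ¬ p.Compatible q) → A.Countable) :=
  ⟨LOCStarCond.exists_le_two_mul_card_le,
    fun _ _ => LOCStarCond.compatible_of_two_mul_card_le,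
    LOCStarCond.exists_linked_cover,
    fun _ => LOCStarCond.countable_of_antichain⟩
end
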